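/- Let p be a prime, d ≥ 1, g : Z_p^d → ℂ with ‖g‖₂ = 1, E = supp(g), and A, B ⊆ Z_p^d with |E| = |B|. Then G(g, A, B) is an orthonormal basis of L²(Z_p^d) if and only if the following three conditions hold: (i) |g| = |E|^{-1/2}·1_E; (ii) (E, B) is a spectral pair; (iii) (E, A) is a tiling pair. -/

import Mathlib

open Finset

/-- The fixed character `χ(t) = e^{2πi t/p}` of `ℤ/p`. -/
noncomputable def chi (p : ℕ) (t : ZMod p) : ℂ :=
  Complex.exp (2 * Real.pi * Complex.I * (t.val : ℂ) / (p : ℂ))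

/-- The dot product on `ℤ_p^d`. -/
def dotp {p d : ℕ} (x y : Fin d → ZMod p) : ZMod p := ∑ i, x i * y i

/-- The Gabor (time-frequency shifted) function `x ↦ g(x-a) χ(x·b)`. -/
noncomputable def gabor {p d : ℕ} (g : (Fin d → ZMod p) → ℂ) (a b : Fin d → ZMod p) :
    (Fin d → ZMod p) → ℂ :=
  fun x => g (x - a) * chi p (dotp x b)

/-- The inner product of `L²` with counting measure on a finite type. -/
noncomputable def innerC {V : Type*} [Fintype V] (f g : V → ℂ) : ℂ :=
  ∑ x, f x * (starRingEnd ℂ) (g x)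

/-- `𝒢(g, A, B)` is an orthonormal basis of `L²(ℤ_p^d)`: the family is orthonormal and
every function is a linear combination of its members. -/
def IsGaborONB {p d : ℕ} [NeZero p] (g : (Fin d → ZMod p) → ℂ)
    (A B : Finset (Fin d → ZMod p)) : Prop :=
  (∀ a ∈ A, ∀ b ∈ B, ∀ a' ∈ A, ∀ b' ∈ B,
    innerC (gabor g a b) (gabor g a' b') = if a = a' ∧ b = b' then 1 else 0)
  ∧ (∀ f : (Fin d → ZMod p) → ℂ, ∃ c : (Fin d → ZMod p) → (Fin d → ZMod p) → ℂ,
      f = fun x => ∑ a ∈ A, ∑ b ∈ B, c a b * gabor g a b x)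

/-- `(E, B)` is a spectral pair: the characters indexed by `B` are pairwise orthogonal in
`L²(E)` and span it. -/
def IsSpectralPair {p d : ℕ} [NeZero p] (E B : Finset (Fin d → ZMod p)) : Prop :=
  (∀ b ∈ B, ∀ b' ∈ B, b ≠ b' → ∑ x ∈ E, chi p (dotp x (b - b')) = 0)
  ∧ (∀ f : (Fin d → ZMod p) → ℂ, ∃ c : (Fin d → ZMod p) → ℂ,
      ∀ x ∈ E, f x = ∑ b ∈ B, c b * chi p (dotp x b))

/-- `(E, A)` is a tiling pair: `Σ_{a∈A} 1_E(x-a) = 1` for every `x`. -/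
def IsTilingPair {p d : ℕ} [NeZero p] (E A : Finset (Fin d → ZMod p)) : Prop :=
  ∀ x : Fin d → ZMod p, (∑ a ∈ A, if x - a ∈ E then (1 : ℕ) else 0) = 1

/-- The Fourier transform `ĝ(m) = p^{-d} Σ_x χ(-x·m) g(x)` on `ℤ_p^d`. -/
noncomputable def ft {p d : ℕ} [NeZero p] (g : (Fin d → ZMod p) → ℂ)
    (m : Fin d → ZMod p) : ℂ :=
  ((p : ℂ) ^ d)⁻¹ * ∑ x, chi p (-(dotp x m)) * g x

theorem chi_eq_stdAddChar {p : ℕ} [NeZero p] (t : ZMod p) : chi p t = ZMod.stdAddChar t := by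
  rw [ZMod.stdAddChar_apply, ZMod.toCircle_apply, chi]

theorem chi_zero {p : ℕ} [NeZero p] : chi p 0 = 1 := by
  simp [chi_eq_stdAddChar]

theorem chi_add {p : ℕ} [NeZero p] (s t : ZMod p) : chi p (s + t) = chi p s * chi p t := by
  simp [chi_eq_stdAddChar, AddChar.map_add_eq_mul]

theorem chi_neg {p : ℕ} [NeZero p] (t : ZMod p) : chi p (-t) = (starRingEnd ℂ) (chi p t) := by
  simp [chi_eq_stdAddChar, AddChar.map_neg_eq_conj]

theorem chi_sub {p : ℕ} [NeZero p] (s t : ZMod p) :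
    chi p (s - t) = chi p s * (starRingEnd ℂ) (chi p t) := by
  rw [sub_eq_add_neg, chi_add, chi_neg]

theorem chi_ne_zero {p : ℕ} (t : ZMod p) : chi p t ≠ 0 :=
  Complex.exp_ne_zero _

theorem dotp_add_left {p d : ℕ} (x y b : Fin d → ZMod p) :
    dotp (x + y) b = dotp x b + dotp y b :=
  add_dotProduct x y b

theorem dotp_sub_left {p d : ℕ} (x y b : Fin d → ZMod p) :
    dotp (x - y) b = dotp x b - dotp y b :=
  sub_dotProduct x y b

theorem dotp_sub_right {p d : ℕ} (x b c : Fin d → ZMod p) :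
    dotp x (b - c) = dotp x b - dotp x c :=
  dotProduct_sub x b c

theorem dotp_zero_left {p d : ℕ} (b : Fin d → ZMod p) : dotp 0 b = 0 :=
  zero_dotProduct b

theorem dotp_zero_right {p d : ℕ} (x : Fin d → ZMod p) : dotp x 0 = 0 :=
  dotProduct_zero x

theorem innerC_gabor {p d : ℕ} [NeZero p] (g : (Fin d → ZMod p) → ℂ)
    (a b a' b' : Fin d → ZMod p) :
    innerC (gabor g a b) (gabor g a' b') =
      ∑ x, g (x - a) * (starRingEnd ℂ) (g (x - a')) * chi p (dotp x (b - b')) := by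
  unfold innerC gabor
  refine sum_congr rfl fun x _ => ?_
  rw [dotp_sub_right, chi_sub, map_mul]
  ring

/-- Two Gabor functions with the same translation have the inner product of the untranslated
window up to a unimodular factor. -/
theorem innerC_gabor_same_translation {p d : ℕ} [NeZero p] (g : (Fin d → ZMod p) → ℂ)
    (a b b' : Fin d → ZMod p) :
    innerC (gabor g a b) (gabor g a b') =
      chi p (dotp a (b - b')) * ∑ x, ((‖g x‖ ^ 2 : ℝ) : ℂ) * chi p (dotp x (b - b')) := by
  rw [innerC_gabor, mul_sum, ← Equiv.sum_comp (Equiv.addRight a)]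
  refine sum_congr rfl fun x _ => ?_
  rw [Equiv.coe_addRight, add_sub_cancel_right, dotp_add_left, chi_add, Complex.mul_conj,
    Complex.normSq_eq_norm_sq]
  ring

/-- If the modulations of `g` by `B` are orthonormal and `|B|` is the size of the support `E`,
then the square matrix `(g x χ(x·b))` is unitary, so its columns are orthonormal as well. -/
theorem sum_modulation_of_orthonormal {p d : ℕ} [NeZero p] {g : (Fin d → ZMod p) → ℂ}
    {E B : Finset (Fin d → ZMod p)} (hE : ∀ x, x ∈ E ↔ g x ≠ 0) (hEB : E.card = B.card)
    (h : ∀ b ∈ B, ∀ b' ∈ B, ∑ x, ((‖g x‖ ^ 2 : ℝ) : ℂ) * chi p (dotp x (b - b')) =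
      if b = b' then 1 else 0)
    {x y : Fin d → ZMod p} (hx : x ∈ E) (hy : y ∈ E) :
    (starRingEnd ℂ) (g x) * g y * ∑ b ∈ B, chi p (dotp (y - x) b) = if x = y then 1 else 0 := by
  let U : Matrix B E ℂ := Matrix.of fun b x => g x * chi p (dotp x.1 b.1)
  have hU : U * U.conjTranspose = 1 := by
    ext b b'
    rw [Matrix.mul_apply, Matrix.one_apply]
    have := h b b.2 b' b'.2
    simp only [← Subtype.ext_iff] at this
    rw [← this, ← sum_subset (subset_univ E), ← sum_coe_sort E]
    · refine sum_congr rfl fun x _ => ?_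
      simp only [Matrix.conjTranspose_apply, RCLike.star_def, U, Matrix.of_apply, map_mul]
      rw [dotp_sub_right, chi_sub, ← Complex.normSq_eq_norm_sq, ← Complex.mul_conj]
      ring
    · intro x _ hx
      simp [not_not.mp (mt (hE x).mpr hx)]
  have hU' : U.conjTranspose * U = 1 :=
    (Matrix.mul_eq_one_comm_of_card_eq _ _ _ (by simpa using hEB.symm)).mp hU
  have := congrFun (congrFun hU' ⟨x, hx⟩) ⟨y, hy⟩
  rw [Matrix.mul_apply, Matrix.one_apply] at this
  simp only [Subtype.mk.injEq] at this
  rw [← this, mul_sum, ← sum_coe_sort B]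
  refine sum_congr rfl fun b _ => ?_
  simp only [Matrix.conjTranspose_apply, RCLike.star_def, U, Matrix.of_apply, map_mul]
  rw [dotp_sub_left, chi_sub]
  ring

theorem isSpectralPair_of_dual_orthogonality {p d : ℕ} [NeZero p]
    {E B : Finset (Fin d → ZMod p)} (hcard : (E.card : ℂ) ≠ 0)
    (horth : ∀ b ∈ B, ∀ b' ∈ B, b ≠ b' → ∑ x ∈ E, chi p (dotp x (b - b')) = 0)
    (hdual : ∀ x ∈ E, ∀ y ∈ E,
      ∑ b ∈ B, chi p (dotp (y - x) b) = if x = y then (E.card : ℂ) else 0) :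
    IsSpectralPair E B := by
  refine ⟨horth, fun f => ⟨fun b => (E.card : ℂ)⁻¹ *
    ∑ x ∈ E, f x * (starRingEnd ℂ) (chi p (dotp x b)), fun y hy => ?_⟩⟩
  calc f y = (E.card : ℂ)⁻¹ * ∑ x ∈ E, f x * ∑ b ∈ B, chi p (dotp (y - x) b) := by
        rw [sum_congr rfl fun x hx => by rw [hdual x hx y hy]]
        simp only [mul_ite, mul_zero]
        rw [sum_ite_eq_of_mem' E y _ hy]
        field_simp
    _ = _ := by
        simp only [mul_sum, sum_mul]
        rw [sum_comm]
        refine sum_congr rfl fun b _ => sum_congr rfl fun x _ => ?_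
        rw [dotp_sub_left, chi_sub]
        ring

/-- A tiling pair says that every point lies in exactly one translate. -/
theorem isTilingPair_iff_existsUnique {p d : ℕ} [NeZero p] {E A : Finset (Fin d → ZMod p)} :
    IsTilingPair E A ↔ ∀ x, ∃! a, a ∈ A ∧ x - a ∈ E := by
  refine forall_congr' fun x => ?_
  rw [sum_boole, Nat.cast_id, card_eq_one]
  simp only [ExistsUnique, Finset.ext_iff, mem_filter, mem_singleton]
  exact exists_congr fun a => ⟨fun h => ⟨(h a).mpr rfl, fun b => (h b).mp⟩,
    fun h b => ⟨h.2 b, fun hb => hb ▸ h.1⟩⟩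

theorem IsGaborONB.exists_translate_mem {p d : ℕ} [NeZero p] {g : (Fin d → ZMod p) → ℂ}
    {A B : Finset (Fin d → ZMod p)} (h : IsGaborONB g A B) (x : Fin d → ZMod p) :
    ∃ a ∈ A, g (x - a) ≠ 0 := by
  by_contra! hx
  obtain ⟨c, hc⟩ := h.2 fun _ => 1
  have hcx := congrFun hc x
  rw [sum_eq_zero fun a ha => sum_eq_zero fun b _ => by simp [gabor, hx a ha]] at hcx
  exact one_ne_zero hcx

theorem IsGaborONB.translate_unique {p d : ℕ} [NeZero p] {g : (Fin d → ZMod p) → ℂ}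
    {E A B : Finset (Fin d → ZMod p)} (h : IsGaborONB g A B) (hE : ∀ x, x ∈ E ↔ g x ≠ 0)
    (hB : B.Nonempty)
    (hdual : ∀ x ∈ E, ∀ y ∈ E,
      ∑ b ∈ B, chi p (dotp (y - x) b) = if x = y then (E.card : ℂ) else 0)
    {x a a' : Fin d → ZMod p} (ha : a ∈ A) (ha' : a' ∈ A) (hx : x - a ∈ E) (hx' : x - a' ∈ E) :
    a = a' := by
  by_contra hne
  obtain ⟨b', hb'⟩ := hB
  have hzero : ∑ b ∈ B, (starRingEnd ℂ) (chi p (dotp x b)) *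
      innerC (gabor g a b) (gabor g a' b') = 0 :=
    sum_eq_zero fun b hb => by rw [h.1 a ha b hb a' ha' b' hb']; simp [hne]
  have hsum : ∑ b ∈ B, (starRingEnd ℂ) (chi p (dotp x b)) *
      innerC (gabor g a b) (gabor g a' b') =
      ∑ y, g (y - a) * (starRingEnd ℂ) (g (y - a')) * (starRingEnd ℂ) (chi p (dotp y b')) *
        ∑ b ∈ B, chi p (dotp (y - x) b) := by
    simp only [innerC_gabor, mul_sum]
    rw [sum_comm]
    refine sum_congr rfl fun y _ => sum_congr rfl fun b _ => ?_
    rw [dotp_sub_left, dotp_sub_right, chi_sub, chi_sub]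
    ring
  rw [hsum, sum_eq_single x] at hzero
  · rw [sub_self] at hzero
    simp only [dotp_zero_left, chi_zero, sum_const, nsmul_eq_mul, mul_one] at hzero
    have hBc : (B.card : ℂ) ≠ 0 := by simpa using Finset.ne_empty_of_mem hb'
    simp_all [chi_ne_zero]
  · intro y _ hy
    by_cases hya : y - a ∈ E
    · have := hdual _ hx _ hya
      rw [sub_sub_sub_cancel_right, if_neg (by simpa using hy.symm)] at this
      rw [this, mul_zero]
    · simp [not_not.mp (mt (hE _).mpr hya)]
  · simp

theorem isGaborONB_of_spectral_of_tiling {p d : ℕ} [NeZero p] {g : (Fin d → ZMod p) → ℂ}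
    {E A B : Finset (Fin d → ZMod p)} (hE : ∀ x, x ∈ E ↔ g x ≠ 0) (hcard : (E.card : ℂ) ≠ 0)
    (hg : ∀ x, ‖g x‖ = if x ∈ E then (Real.sqrt E.card)⁻¹ else 0)
    (hspec : IsSpectralPair E B) (htile : IsTilingPair E A) : IsGaborONB g A B := by
  rw [isTilingPair_iff_existsUnique] at htile
  have hzero : ∀ x, x ∉ E → g x = 0 := fun x hx => not_not.mp (mt (hE x).mpr hx)
  refine ⟨fun a ha b hb a' ha' b' hb' => ?_, fun f => ?_⟩
  · by_cases haa : a = a'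
    · subst haa
      have hsum : ∑ x, ((‖g x‖ ^ 2 : ℝ) : ℂ) * chi p (dotp x (b - b')) =
          (E.card : ℂ)⁻¹ * ∑ x ∈ E, chi p (dotp x (b - b')) := by
        rw [mul_sum, ← sum_subset (subset_univ E)]
        · refine sum_congr rfl fun x hx => ?_
          rw [hg x, if_pos hx, inv_pow, Real.sq_sqrt (Nat.cast_nonneg _)]
          push_cast
          rfl
        · intro x _ hx
          simp [hzero x hx]
      rw [innerC_gabor_same_translation, hsum]
      by_cases hbb : b = b'
      · subst hbb
        simp [dotp_zero_right, chi_zero, hcard]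
      · simp [hspec.1 b hb b' hb' hbb, hbb]
    · rw [innerC_gabor, if_neg fun h => haa h.1]
      refine sum_eq_zero fun x _ => ?_
      by_cases hx : x - a ∈ E
      · have hx' : x - a' ∉ E := fun hx' => haa ((htile x).unique ⟨ha, hx⟩ ⟨ha', hx'⟩)
        simp [hzero _ hx']
      · simp [hzero _ hx]
  · choose c hc using fun a : Fin d → ZMod p => hspec.2 fun x => f (x + a) / g x
    refine ⟨fun a b => c a b * (starRingEnd ℂ) (chi p (dotp a b)), funext fun x => ?_⟩
    obtain ⟨a, ⟨ha, hx⟩, huniq⟩ := htile x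
    rw [sum_eq_single_of_mem a ha]
    · have hcx := hc a (x - a) hx
      rw [sub_add_cancel, div_eq_iff ((hE _).mp hx), sum_mul] at hcx
      rw [hcx]
      refine sum_congr rfl fun b _ => ?_
      rw [dotp_sub_left, chi_sub, gabor]
      ring
    · intro a' ha' hne
      have hx' : x - a' ∉ E := fun hx' => hne (huniq a' ⟨ha', hx'⟩)
      exact sum_eq_zero fun b _ => by simp [gabor, hzero _ hx']

/-- If `‖g‖₂ = 1`, `E = supp g` and `|E| = |B|`, then `𝒢(g,A,B)` is an
orthonormal basis of `L²(ℤ_p^d)` iff `|g| = |E|^{-1/2} 1_E`, `(E,B)` is a spectral pair and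
`(E,A)` is a tiling pair. -/
theorem gabor_onb_iff_of_card_support_eq_card_modulation
    (p : ℕ) [Fact p.Prime] (d : ℕ) (hd : 1 ≤ d)
    (g : (Fin d → ZMod p) → ℂ) (hg : ∑ x, ‖g x‖ ^ 2 = 1)
    (E : Finset (Fin d → ZMod p)) (hE : E = Finset.univ.filter (fun x => g x ≠ 0))
    (A B : Finset (Fin d → ZMod p)) (hEB : E.card = B.card) :
    IsGaborONB g A B ↔
      ((∀ x, ‖g x‖ = if x ∈ E then (Real.sqrt E.card)⁻¹ else 0)
        ∧ IsSpectralPair E B ∧ IsTilingPair E A) := by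
  have hsupp : ∀ x, x ∈ E ↔ g x ≠ 0 := by simp [hE]
  have hne : E.Nonempty := by
    by_contra hemp
    rw [not_nonempty_iff_eq_empty] at hemp
    have hzero : ∀ x, g x = 0 := fun x => not_not.mp (mt (hsupp x).mpr (by simp [hemp]))
    simp [hzero] at hg
  have hcard : (E.card : ℂ) ≠ 0 := by simpa using hne.ne_empty
  have hBne : B.Nonempty := card_pos.mp (hEB ▸ hne.card_pos)
  refine ⟨fun h => ?_, fun ⟨hflat, hspec, htile⟩ =>
    isGaborONB_of_spectral_of_tiling hsupp hcard hflat hspec htile⟩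
  obtain ⟨a, ha, -⟩ := h.exists_translate_mem 0
  have hgram : ∀ b ∈ B, ∀ b' ∈ B,
      ∑ x, ((‖g x‖ ^ 2 : ℝ) : ℂ) * chi p (dotp x (b - b')) = if b = b' then 1 else 0 := by
    intro b hb b' hb'
    have hab := h.1 a ha b hb a ha b' hb'
    rw [innerC_gabor_same_translation] at hab
    by_cases hbb : b = b'
    · subst hbb
      simpa [dotp_zero_right, chi_zero] using hab
    · simpa [hbb, chi_ne_zero] using hab
  have hcol := fun {x y} hx hy =>
    sum_modulation_of_orthonormal (x := x) (y := y) hsupp hEB hgram hx hy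
  have hsq : ∀ x ∈ E, ‖g x‖ ^ 2 = (E.card : ℝ)⁻¹ := by
    intro x hx
    have hxx := hcol hx hx
    simp only [sub_self, dotp_zero_left, chi_zero, sum_const, nsmul_eq_mul, mul_one, if_true,
      ← hEB, Complex.conj_mul'] at hxx
    exact eq_inv_of_mul_eq_one_left (mod_cast hxx)
  have hdual : ∀ x ∈ E, ∀ y ∈ E,
      ∑ b ∈ B, chi p (dotp (y - x) b) = if x = y then (E.card : ℂ) else 0 := by
    intro x hx y hy
    by_cases hxy : x = y
    · subst hxy
      simp [dotp_zero_left, chi_zero, hEB]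
    · simpa [hxy, (hsupp x).mp hx, (hsupp y).mp hy] using hcol hx hy
  refine ⟨fun x => ?_, isSpectralPair_of_dual_orthogonality hcard (fun b hb b' hb' hbb => ?_)
    hdual, isTilingPair_iff_existsUnique.mpr fun x => ?_⟩
  · split_ifs with hx
    · rw [← Real.sqrt_inv, ← hsq x hx, Real.sqrt_sq (norm_nonneg _)]
    · simpa using mt (hsupp x).mpr hx
  · have hbb' := hgram b hb b' hb'
    rw [if_neg hbb, ← sum_subset (subset_univ E), sum_congr rfl fun x hx => by rw [hsq x hx],
      ← mul_sum] at hbb'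
    · simpa [hne.ne_empty] using hbb'
    · intro x _ hx
      simp [not_not.mp (mt (hsupp x).mpr hx)]
  · obtain ⟨a', ha', hx⟩ := h.exists_translate_mem x
    rw [← hsupp] at hx
    exact ⟨a', ⟨ha', hx⟩, fun c ⟨hc, hxc⟩ =>
      h.translate_unique hsupp hBne hdual hc ha' hxc hx⟩
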